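/- arXiv:2505.15786 — 6 statements merged into one kernel-verified Lean document; each statement's English description precedes it below -/
import Mathlib

section
/- Let R be a commutative ring. The space PrimeSpectrum R is finite if and only if it is weakly Noetherian (every singleton subset is weakly visible) and inverse-Noetherian (the inverse topology on PrimeSpectrum R is a Noetherian topological space). -/
open TopologicalSpace Set

/-- A subset of `PrimeSpectrum R` is *Thomason* if it is a union of complements of
quasi-compact Zariski-open sets. -/
def IsThomason {R : Type*} [CommRing R] (W : Set (PrimeSpectrum R)) : Prop :=
  ∃ 𝒮 : Set (Set (PrimeSpectrum R)),
    (∀ U ∈ 𝒮, IsOpen U ∧ IsCompact U) ∧ W = ⋃ U ∈ 𝒮, Uᶜ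

/-- The inverse (Hochster dual) topology on `PrimeSpectrum R`, generated by the
complements of the quasi-compact Zariski-open sets. -/
def inverseTopology (R : Type*) [CommRing R] : TopologicalSpace (PrimeSpectrum R) :=
  TopologicalSpace.generateFrom
    {s : Set (PrimeSpectrum R) | ∃ U : Set (PrimeSpectrum R), IsOpen U ∧ IsCompact U ∧ s = Uᶜ}

/-- A subset of `PrimeSpectrum R` is *weakly visible* if it is the intersection of a
Thomason subset with the complement of a Thomason subset. -/
def IsWeaklyVisible {R : Type*} [CommRing R] (V : Set (PrimeSpectrum R)) : Prop :=
  ∃ W₁ W₂ : Set (PrimeSpectrum R), IsThomason W₁ ∧ IsThomason W₂ ∧ V = W₁ ∩ W₂ᶜ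

/-- A subset of `PrimeSpectrum R` is *constructible* (w.r.t. the Zariski topology) if it
is a finite union of differences `Uᵢ \ Vᵢ` of quasi-compact Zariski-open sets. -/
def IsConstructible {R : Type*} [CommRing R] (s : Set (PrimeSpectrum R)) : Prop :=
  ∃ (n : ℕ) (U V : Fin n → Set (PrimeSpectrum R)),
    (∀ i, IsOpen (U i) ∧ IsCompact (U i)) ∧ (∀ i, IsOpen (V i) ∧ IsCompact (V i)) ∧
    s = ⋃ i, U i ∩ (V i)ᶜ

/-- The constructible (patch) topology on `PrimeSpectrum R`, generated by the
quasi-compact Zariski-open sets together with their complements. -/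
def patchTopology (R : Type*) [CommRing R] : TopologicalSpace (PrimeSpectrum R) :=
  TopologicalSpace.generateFrom
    ({U : Set (PrimeSpectrum R) | IsOpen U ∧ IsCompact U} ∪
      {s : Set (PrimeSpectrum R) | ∃ U : Set (PrimeSpectrum R), IsOpen U ∧ IsCompact U ∧ s = Uᶜ})

open scoped Topology

/-- A Thomason subset is open in the constructible topology. -/
lemma IsThomason.isOpen_constructibleTopology {R : Type*} [CommRing R]
    {W : Set (PrimeSpectrum R)} (hW : IsThomason W) :
    IsOpen[constructibleTopology (PrimeSpectrum R)] W := by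
  obtain ⟨𝒮, h𝒮, rfl⟩ := hW
  exact @isOpen_biUnion _ _ (constructibleTopology _) _ _ fun U hU ↦
    IsCompact.isOpen_constructibleTopology_of_isClosed (by simpa using (h𝒮 U hU).2)
      (h𝒮 U hU).1.isClosed_compl

/-- If the inverse topology is Noetherian, a Thomason subset is a finite union of complements of
quasi-compact open sets. -/
lemma IsThomason.exists_finite {R : Type*} [CommRing R]
    (hN : @NoetherianSpace (PrimeSpectrum R) (inverseTopology R))
    {W : Set (PrimeSpectrum R)} (hW : IsThomason W) :
    ∃ 𝒯 : Set (Set (PrimeSpectrum R)), 𝒯.Finite ∧ (∀ U ∈ 𝒯, IsOpen U ∧ IsCompact U) ∧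
      W = ⋃ U ∈ 𝒯, Uᶜ := by
  obtain ⟨𝒮, h𝒮, rfl⟩ := hW
  have hc := @NoetherianSpace.isCompact _ (inverseTopology R) hN (⋃ U ∈ 𝒮, Uᶜ)
  obtain ⟨𝒯, h𝒯, hfin, hcov⟩ := @IsCompact.elim_finite_subcover_image _ _ (inverseTopology R)
    _ 𝒮 compl hc
    (fun U hU ↦ isOpen_generateFrom_of_mem ⟨U, (h𝒮 U hU).1, (h𝒮 U hU).2, rfl⟩) subset_rfl
  exact ⟨𝒯, hfin, fun U hU ↦ h𝒮 U (h𝒯 hU), hcov.antisymm (biUnion_subset_biUnion_left h𝒯)⟩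

/-- If the inverse topology is Noetherian, the complement of a Thomason subset is open in the
constructible topology. -/
lemma IsThomason.isOpen_compl_constructibleTopology {R : Type*} [CommRing R]
    (hN : @NoetherianSpace (PrimeSpectrum R) (inverseTopology R))
    {W : Set (PrimeSpectrum R)} (hW : IsThomason W) :
    IsOpen[constructibleTopology (PrimeSpectrum R)] Wᶜ := by
  obtain ⟨𝒯, hfin, h𝒯, rfl⟩ := hW.exists_finite hN
  simp only [compl_iUnion, compl_compl]
  exact @Set.Finite.isOpen_biInter _ _ (constructibleTopology _) _ _ hfin fun U hU ↦
    (h𝒯 U hU).2.isOpen_constructibleTopology_of_isOpen (h𝒯 U hU).1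

/-- If the inverse topology is Noetherian, a weakly visible subset is open in the constructible
topology. -/
lemma IsWeaklyVisible.isOpen_constructibleTopology {R : Type*} [CommRing R]
    (hN : @NoetherianSpace (PrimeSpectrum R) (inverseTopology R))
    {V : Set (PrimeSpectrum R)} (hV : IsWeaklyVisible V) :
    IsOpen[constructibleTopology (PrimeSpectrum R)] V := by
  obtain ⟨W₁, W₂, h₁, h₂, rfl⟩ := hV
  exact @IsOpen.inter _ (constructibleTopology _) _ _ h₁.isOpen_constructibleTopology
    (h₂.isOpen_compl_constructibleTopology hN)

/-- In a finite spectrum, every point is the intersection of its closure with its set of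
generalizations, hence weakly visible. -/
lemma IsWeaklyVisible.singleton_of_finite {R : Type*} [CommRing R] [Finite (PrimeSpectrum R)]
    (x : PrimeSpectrum R) : IsWeaklyVisible {x} := by
  refine ⟨closure {x}, ⋃ U ∈ {U : Set (PrimeSpectrum R) | IsOpen U ∧ x ∈ U}, Uᶜ,
    ⟨{(closure {x})ᶜ}, ?_, by simp⟩, ⟨_, fun U hU ↦ ⟨hU.1, U.toFinite.isCompact⟩, rfl⟩, ?_⟩
  · rintro U rfl
    exact ⟨isClosed_closure.isOpen_compl, (Set.toFinite _).isCompact⟩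
  · refine subset_antisymm ?_ fun y ⟨hy, hyU⟩ ↦ ?_
    · simpa using subset_closure (mem_singleton x)
    · have hyx : y ⤳ x := specializes_iff_forall_open.mpr fun U hU hxU ↦ by
        by_contra h
        exact hyU (mem_biUnion (show U ∈ {U | IsOpen U ∧ x ∈ U} from ⟨hU, hxU⟩) h)
      exact (hyx.antisymm (specializes_iff_mem_closure.mpr hy)).eq

theorem finite_iff_weaklyNoetherian_and_inverseNoetherian {R : Type*} [CommRing R] :
    Finite (PrimeSpectrum R) ↔
      (∀ x : PrimeSpectrum R, IsWeaklyVisible {x}) ∧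
        @TopologicalSpace.NoetherianSpace (PrimeSpectrum R) (inverseTopology R) := by
  refine ⟨fun h ↦ ⟨IsWeaklyVisible.singleton_of_finite, ?_⟩, fun ⟨hV, hN⟩ ↦ ?_⟩
  · exact @Finite.to_noetherianSpace _ (inverseTopology R) h
  · have : DiscreteTopology (WithConstructibleTopology (PrimeSpectrum R)) :=
      discreteTopology_iff_isOpen_singleton.mpr fun x ↦ by
        rw [WithConstructibleTopology.isOpen_iff]
        convert (hV (WithTopology.ofTopology x)).isOpen_constructibleTopology hN using 1
        ext y
        simp [WithTopology.ext_iff]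
    have : Finite (WithConstructibleTopology (PrimeSpectrum R)) := finite_of_compact_of_discrete
    exact Finite.of_equiv (WithConstructibleTopology (PrimeSpectrum R)) (WithTopology.equiv _ _)
end

section
/- Let R be a commutative ring. If every singleton of PrimeSpectrum R is weakly visible and the inverse topology on PrimeSpectrum R is Noetherian, then every singleton of PrimeSpectrum R is open in the constructible (patch) topology, i.e., the constructible topology on PrimeSpectrum R is discrete. -/
open TopologicalSpace Set

open scoped Topology

theorem isOpen_patchTopology_of_isCompact {R : Type*} [CommRing R] {U : Set (PrimeSpectrum R)}
    (hU : IsOpen U) (hc : IsCompact U) : IsOpen[patchTopology R] U :=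
  isOpen_generateFrom_of_mem (Or.inl ⟨hU, hc⟩)

theorem isOpen_patchTopology_compl_of_isCompact {R : Type*} [CommRing R]
    {U : Set (PrimeSpectrum R)} (hU : IsOpen U) (hc : IsCompact U) :
    IsOpen[patchTopology R] Uᶜ :=
  isOpen_generateFrom_of_mem (Or.inr ⟨U, hU, hc, rfl⟩)

theorem IsThomason.isOpen_patchTopology {R : Type*} [CommRing R] {W : Set (PrimeSpectrum R)}
    (hW : IsThomason W) : IsOpen[patchTopology R] W := by
  obtain ⟨S, hS, rfl⟩ := hW
  exact @isOpen_biUnion _ _ (patchTopology R) _ _ fun U hU ↦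
    isOpen_patchTopology_compl_of_isCompact (hS U hU).1 (hS U hU).2

/-- If the inverse topology is Noetherian, a Thomason subset is a finite union of complements of
quasi-compact opens, so its complement is open in the patch topology. -/
theorem IsThomason.isOpen_patchTopology_compl {R : Type*} [CommRing R]
    (h : @NoetherianSpace (PrimeSpectrum R) (inverseTopology R)) {W : Set (PrimeSpectrum R)}
    (hW : IsThomason W) : IsOpen[patchTopology R] Wᶜ := by
  obtain ⟨S, hS, rfl⟩ := hW
  obtain ⟨T, hTS, hT, hcover⟩ := @IsCompact.elim_finite_subcover_image _ _ (inverseTopology R) _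
    _ compl (@NoetherianSpace.isCompact _ (inverseTopology R) h (⋃ U ∈ S, Uᶜ))
    (fun U hU ↦ isOpen_generateFrom_of_mem ⟨U, (hS U hU).1, (hS U hU).2, rfl⟩) subset_rfl
  rw [hcover.antisymm (biUnion_subset_biUnion_left hTS)]
  simp only [compl_iUnion, compl_compl]
  exact @Set.Finite.isOpen_biInter _ _ (patchTopology R) _ _ hT fun U hU ↦
    isOpen_patchTopology_of_isCompact (hS U (hTS hU)).1 (hS U (hTS hU)).2

theorem patch_discrete_of_weaklyNoetherian_of_inverseNoetherian {R : Type*} [CommRing R]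
    (h₁ : ∀ x : PrimeSpectrum R, IsWeaklyVisible {x})
    (h₂ : @TopologicalSpace.NoetherianSpace (PrimeSpectrum R) (inverseTopology R)) :
    ∀ x : PrimeSpectrum R, @IsOpen (PrimeSpectrum R) (patchTopology R) {x} := by
  intro x
  obtain ⟨W₁, W₂, hW₁, hW₂, hx⟩ := h₁ x
  rw [hx]
  exact @IsOpen.inter _ (patchTopology R) _ _ hW₁.isOpen_patchTopology
    (hW₂.isOpen_patchTopology_compl h₂)
end

section
/- Let R be a commutative ring. The inverse topology on PrimeSpectrum R is Noetherian if and only if for every point x of PrimeSpectrum R the set of generalizations of x, i.e., { y ∈ PrimeSpectrum R | x ∈ closure {y} }, is a constructible subset of PrimeSpectrum R (with respect to the Zariski topology). -/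
open TopologicalSpace Set

lemma setOf_mem_closure_singleton_eq_nhdsKer {X : Type*} [TopologicalSpace X] (x : X) :
    {y | x ∈ closure {y}} = nhdsKer {x} := by
  ext y
  rw [mem_nhdsKer_singleton, specializes_iff_mem_closure, mem_ofPred]

lemma isOpen_of_stableUnderGeneralization_of_isOpen_nhdsKer {X : Type*} [TopologicalSpace X]
    (h : ∀ x : X, IsOpen (nhdsKer {x})) {s : Set X} (hs : StableUnderGeneralization s) :
    IsOpen s := by
  refine isOpen_iff_forall_mem_open.2 fun x hx ↦ ⟨nhdsKer {x}, fun y hy ↦ ?_, h x, ?_⟩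
  · exact hs (mem_nhdsKer_singleton.1 hy) hx
  · exact mem_nhdsKer_singleton.2 specializes_rfl

lemma constructibleTopology_le {X : Type*} [t : TopologicalSpace X] [PrespectralSpace X] :
    constructibleTopology X ≤ t := by
  refine le_trans ?_ (PrespectralSpace.isTopologicalBasis (X := X)).eq_generateFrom.ge
  exact le_generateFrom fun U hU ↦ hU.2.isOpen_constructibleTopology_of_isOpen hU.1

lemma IsClosed.isCompact_constructibleTopology {X : Type*} [TopologicalSpace X]
    [SpectralSpace X] {s : Set X} (hs : IsClosed s) :
    @IsCompact X (constructibleTopology X) s := by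
  have hc : IsClosed (WithTopology.ofTopology (t := constructibleTopology X) ⁻¹' s) :=
    WithConstructibleTopology.isClosed_iff.2 (hs.mono constructibleTopology_le)
  rw [← image_preimage_eq s
    (WithTopology.ofTopology_surjective (t := constructibleTopology X))]
  exact @IsCompact.image _ _ _ (constructibleTopology X) _ _ hc.isCompact
    (WithTopology.continuous_ofTopology _)

lemma IsCompact.of_topology_le {X : Type*} {t₁ t₂ : TopologicalSpace X} (h : t₁ ≤ t₂) {s : Set X}
    (hs : @IsCompact X t₁ s) : @IsCompact X t₂ s := by
  simpa only [image_id] using @IsCompact.image X X t₁ t₂ s id hs (continuous_id_of_le h)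

section inverseTopology

open Topology

variable {R : Type*} [CommRing R]

lemma Topology.IsConstructible.of_differences {s : Set (PrimeSpectrum R)}
    (hs : _root_.IsConstructible s) : Topology.IsConstructible s := by
  obtain ⟨n, U, V, hU, hV, rfl⟩ := hs
  exact .iUnion fun i ↦ ((hU i).2.isConstructible (hU i).1).inter
    ((hV i).2.isConstructible (hV i).1).compl

lemma IsOpen.isConstructible_of_isCompact {s : Set (PrimeSpectrum R)} (ho : IsOpen s)
    (hc : IsCompact s) : _root_.IsConstructible s :=
  ⟨1, fun _ ↦ s, fun _ ↦ ∅, fun _ ↦ ⟨ho, hc⟩, fun _ ↦ ⟨isOpen_empty, isCompact_empty⟩, by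
    simp [iUnion_const]⟩

lemma isOpen_inverseTopology_compl {U : Set (PrimeSpectrum R)} (ho : IsOpen U)
    (hc : IsCompact U) : IsOpen[inverseTopology R] Uᶜ :=
  isOpen_generateFrom_of_mem ⟨U, ho, hc, rfl⟩

lemma constructibleTopology_le_inverseTopology :
    constructibleTopology (PrimeSpectrum R) ≤ inverseTopology R := by
  refine le_generateFrom ?_
  rintro _ ⟨U, ho, hc, rfl⟩
  exact IsCompact.isOpen_constructibleTopology_of_isClosed (by rwa [compl_compl]) ho.isClosed_compl

lemma stableUnderSpecialization_of_isOpen_inverseTopology {s : Set (PrimeSpectrum R)}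
    (hs : IsOpen[inverseTopology R] s) : StableUnderSpecialization s := by
  change GenerateOpen _ s at hs
  induction hs with
  | basic s hs =>
    obtain ⟨U, ho, -, rfl⟩ := hs
    exact ho.isClosed_compl.stableUnderSpecialization
  | univ => exact stableUnderSpecialization_univ
  | inter s t _ _ hs ht => exact fun x y h hx ↦ ⟨hs h hx.1, ht h hx.2⟩
  | sUnion S _ hS => exact stableUnderSpecialization_sUnion S hS

/-- If the inverse topology is Noetherian, then `nhdsKer {x}` is
open, being a finite intersection of quasi-compact open sets. -/
lemma isOpen_nhdsKer_of_noetherianSpace_inverseTopology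
    (h : @NoetherianSpace (PrimeSpectrum R) (inverseTopology R)) (x : PrimeSpectrum R) :
    IsOpen (nhdsKer {x}) := by
  have hK : @IsCompact _ (inverseTopology R) (nhdsKer {x})ᶜ :=
    (@noetherianSpace_iff_isCompact _ (inverseTopology R)).1 h _
  let ι := {U : Set (PrimeSpectrum R) // IsOpen U ∧ IsCompact U ∧ x ∈ U}
  obtain ⟨t, ht⟩ := @IsCompact.elim_finite_subcover _ (inverseTopology R) _ ι hK
    (fun U ↦ U.1ᶜ) (fun U ↦ isOpen_inverseTopology_compl U.2.1 U.2.2.1) (by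
      intro y hy
      rw [mem_compl_iff, mem_nhdsKer_singleton, not_specializes_iff_exists_open] at hy
      obtain ⟨V, hV, hxV, hyV⟩ := hy
      obtain ⟨U, ⟨hU, hUc⟩, hxU, hUV⟩ :=
        PrespectralSpace.isTopologicalBasis.exists_subset_of_mem_open hxV hV
      exact mem_iUnion.2 ⟨⟨U, hU, hUc, hxU⟩, fun hyU ↦ hyV (hUV hyU)⟩)
  have heq : nhdsKer {x} = ⋂ U ∈ t, U.1 := by
    refine subset_antisymm (fun y hy ↦ ?_) ?_
    · exact mem_iInter₂.2 fun U _ ↦ (mem_nhdsKer_singleton.1 hy).mem_open U.2.1 U.2.2.2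
    · rw [← compl_subset_compl]
      simpa only [compl_iInter] using ht
  rw [heq]
  exact isOpen_biInter_finset fun U _ ↦ U.2.1

lemma noetherianSpace_inverseTopology_of_isOpen_nhdsKer
    (h : ∀ x : PrimeSpectrum R, IsOpen (nhdsKer {x})) :
    @NoetherianSpace (PrimeSpectrum R) (inverseTopology R) := by
  refine (@noetherianSpace_iff_opens _ (inverseTopology R)).2 ?_
  rintro ⟨s, hs⟩
  have hc : IsClosed s := isOpen_compl_iff.1 <|
    isOpen_of_stableUnderGeneralization_of_isOpen_nhdsKer h
      (stableUnderSpecialization_of_isOpen_inverseTopology hs).compl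
  exact .of_topology_le constructibleTopology_le_inverseTopology hc.isCompact_constructibleTopology

end inverseTopology

theorem inverseNoetherian_iff_generalizations_constructible {R : Type*} [CommRing R] :
    @TopologicalSpace.NoetherianSpace (PrimeSpectrum R) (inverseTopology R) ↔
      ∀ x : PrimeSpectrum R, IsConstructible {y : PrimeSpectrum R | x ∈ closure {y}} := by
  simp_rw [setOf_mem_closure_singleton_eq_nhdsKer]
  refine ⟨fun h x ↦ ?_, fun h ↦ ?_⟩
  · exact (isOpen_nhdsKer_of_noetherianSpace_inverseTopology h x).isConstructible_of_isCompact
      isCompact_singleton.nhdsKer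
  · refine noetherianSpace_inverseTopology_of_isOpen_nhdsKer fun x ↦ ?_
    refine PrimeSpectrum.isOpen_of_stableUnderGeneralization_of_isConstructible
      (fun y z hzy hy ↦ ?_) (.of_differences (h x))
    exact mem_nhdsKer_singleton.2 (hzy.trans (mem_nhdsKer_singleton.1 hy))
end

section
/- Let R be a commutative ring such that PrimeSpectrum R is a Hausdorff topological space. Then every singleton subset of PrimeSpectrum R is weakly visible; that is, PrimeSpectrum R is weakly Noetherian. -/
open TopologicalSpace Set

theorem isThomason_univ {R : Type*} [CommRing R] :
    IsThomason (univ : Set (PrimeSpectrum R)) :=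
  ⟨{∅}, by simp, by simp⟩

theorem isThomason_compl_singleton {R : Type*} [CommRing R] [T1Space (PrimeSpectrum R)]
    (x : PrimeSpectrum R) : IsThomason {x}ᶜ := by
  refine ⟨{U | (IsOpen U ∧ IsCompact U) ∧ x ∈ U}, fun U hU => hU.1, ?_⟩
  ext y
  simp only [mem_compl_iff, mem_singleton_iff, mem_iUnion, mem_ofPred_eq, exists_prop]
  constructor
  · intro hyx
    obtain ⟨_, ⟨f, rfl⟩, hxf, hf⟩ :=
      PrimeSpectrum.isTopologicalBasis_basic_opens.exists_subset_of_mem_open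
        (show x ∈ ({y}ᶜ : Set (PrimeSpectrum R)) from Ne.symm hyx) isOpen_compl_singleton
    exact ⟨_, ⟨⟨(PrimeSpectrum.basicOpen f).isOpen, PrimeSpectrum.isCompact_basicOpen f⟩, hxf⟩,
      fun hy => hf hy rfl⟩
  · rintro ⟨U, ⟨-, hxU⟩, hyU⟩ rfl
    exact hyU hxU

theorem weaklyNoetherian_of_t2Space {R : Type*} [CommRing R]
    [T2Space (PrimeSpectrum R)] :
    ∀ x : PrimeSpectrum R, IsWeaklyVisible {x} :=
  fun x => ⟨univ, {x}ᶜ, isThomason_univ, isThomason_compl_singleton x, by simp⟩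
end

section
/- Let R be a commutative ring such that PrimeSpectrum R is a Noetherian topological space. Then the inverse topology on PrimeSpectrum R is Noetherian if and only if PrimeSpectrum R is finite. -/
open TopologicalSpace Set

/-- A well-quasi-order without infinite strictly ascending chains is finite. -/
theorem finite_of_wellQuasiOrderedLE_of_wellFoundedGT (α : Type*) [PartialOrder α]
    [WellQuasiOrderedLE α] [WellFoundedGT α] : Finite α := by
  by_contra h
  rw [not_finite_iff_infinite] at h
  let f := Infinite.natEmbedding α
  obtain ⟨g, hg⟩ := (wellQuasiOrdered_le (α := α)).exists_monotone_subseq f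
  exact not_strictMono_of_wellFoundedGT (f ∘ g)
    (Monotone.strictMono_of_injective hg (f.injective.comp g.injective))

theorem wellFoundedGT_of_isClosed_Ici (α : Type*) [Preorder α] [TopologicalSpace α]
    [NoetherianSpace α] (h : ∀ a : α, IsClosed (Ici a)) : WellFoundedGT α := by
  have hV : StrictMono fun a : α => (⟨(Ici a)ᶜ, (h a).isOpen_compl⟩ : Opens α) :=
    fun _ _ hab => compl_lt_compl_iff_lt.2 (Ici_ssubset_Ici.2 hab)
  exact hV.wellFoundedGT

theorem wellQuasiOrderedLE_of_isOpen_Ici (α : Type*) [Preorder α] [TopologicalSpace α]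
    [NoetherianSpace α] (h : ∀ a : α, IsOpen (Ici a)) : WellQuasiOrderedLE α := by
  refine ⟨fun f => ?_⟩
  obtain ⟨t, ht⟩ := (NoetherianSpace.isCompact (range f)).elim_finite_subcover
    (fun n => Ici (f n)) (fun n => h (f n))
    (range_subset_iff.2 fun n => mem_iUnion.2 ⟨n, self_mem_Ici⟩)
  obtain ⟨N, hN⟩ := t.exists_nat_subset_range
  obtain ⟨i, hi, hle⟩ := mem_iUnion₂.1 (ht (mem_range_self N))
  exact ⟨i, N, Finset.mem_range.1 (hN hi), hle⟩

theorem PrimeSpectrum.isClosed_Ici {R : Type*} [CommRing R] (p : PrimeSpectrum R) :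
    IsClosed (Ici p) :=
  PrimeSpectrum.isClosed_zeroLocus (p.asIdeal : Set R)

theorem isOpen_inverseTopology_Ici {R : Type*} [CommRing R] [NoetherianSpace (PrimeSpectrum R)]
    (p : PrimeSpectrum R) : @IsOpen _ (inverseTopology R) (Ici p) :=
  isOpen_generateFrom_of_mem ⟨(Ici p)ᶜ, (PrimeSpectrum.isClosed_Ici p).isOpen_compl,
    NoetherianSpace.isCompact _, (compl_compl _).symm⟩

theorem inverseNoetherian_iff_finite_of_noetherian {R : Type*} [CommRing R]
    [TopologicalSpace.NoetherianSpace (PrimeSpectrum R)] :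
    @TopologicalSpace.NoetherianSpace (PrimeSpectrum R) (inverseTopology R) ↔
      Finite (PrimeSpectrum R) := by
  refine ⟨fun h => ?_, fun _ => @Finite.to_noetherianSpace _ (inverseTopology R) _⟩
  have := @wellQuasiOrderedLE_of_isOpen_Ici _ _ (inverseTopology R) h isOpen_inverseTopology_Ici
  have := wellFoundedGT_of_isClosed_Ici _ (PrimeSpectrum.isClosed_Ici (R := R))
  exact finite_of_wellQuasiOrderedLE_of_wellFoundedGT _
end

section
/- Let R and S be commutative rings and let f : PrimeSpectrum S → PrimeSpectrum R be a surjective spectral map (continuous, with preimages of quasi-compact Zariski-open sets quasi-compact). If the inverse topology on PrimeSpectrum S is Noetherian, then the inverse topology on PrimeSpectrum R is Noetherian. -/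
open TopologicalSpace Set

/-- A spectral map is continuous for the inverse topologies. -/
theorem IsSpectralMap.continuous_inverseTopology {R S : Type*} [CommRing R] [CommRing S]
    {f : PrimeSpectrum S → PrimeSpectrum R} (hf : IsSpectralMap f) :
    @Continuous _ _ (inverseTopology S) (inverseTopology R) f := by
  refine (@continuous_generateFrom_iff _ _ f (inverseTopology S) _).2 ?_
  rintro _ ⟨U, hUo, hUc, rfl⟩
  exact isOpen_generateFrom_of_mem
    ⟨f ⁻¹' U, hUo.preimage hf.continuous, hf.isCompact_preimage_of_isOpen hUo hUc, preimage_compl⟩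

theorem inverseNoetherian_of_surjective_spectralMap {R S : Type*} [CommRing R] [CommRing S]
    (f : PrimeSpectrum S → PrimeSpectrum R) (hf : IsSpectralMap f)
    (hsurj : Function.Surjective f)
    (hS : @TopologicalSpace.NoetherianSpace (PrimeSpectrum S) (inverseTopology S)) :
    @TopologicalSpace.NoetherianSpace (PrimeSpectrum R) (inverseTopology R) :=
  @noetherianSpace_of_surjective _ _ (inverseTopology S) (inverseTopology R) hS f
    hf.continuous_inverseTopology hsurj
end
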